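/- Let 2 ≤ ℓ ≤ m−2 and let Π be a hyperplane of the Plücker projective space P(⋀^ℓ V) such that |Π ∩ G(ℓ,V)| < e(ℓ,m). Then |Π ∩ G(ℓ,V)| ≤ e'(ℓ,m) = [m ℓ]_q − q^{ℓ(m−ℓ)} − q^{ℓ(m−ℓ)−2}. -/

import Mathlib

open Module

/-- The Gaussian binomial coefficient `[m ℓ]_q`, as a rational number. -/
noncomputable def gaussBinom (q m l : ℕ) : ℚ :=
  ∏ i ∈ Finset.range l, ((q : ℚ) ^ (m - i) - 1) / ((q : ℚ) ^ (i + 1) - 1)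

/-- `e(ℓ,m) = [m ℓ]_q − q^{ℓ(m−ℓ)}`. -/
noncomputable def eG (q l m : ℕ) : ℚ :=
  gaussBinom q m l - (q : ℚ) ^ (l * (m - l))

/-- `e'(ℓ,m) = [m ℓ]_q − q^{ℓ(m−ℓ)} − q^{ℓ(m−ℓ)−2}`. -/
noncomputable def eG' (q l m : ℕ) : ℚ :=
  gaussBinom q m l - (q : ℚ) ^ (l * (m - l)) - (q : ℚ) ^ (l * (m - l) - 2)

variable (F : Type*) [Field F] (V : Type*) [AddCommGroup V] [Module F V]

/-- The wedge product `v₁ ∧ ⋯ ∧ vₙ` as an element of the `n`-th exterior power. -/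
noncomputable def wedge (n : ℕ) (v : Fin n → V) : ⋀[F]^n V :=
  ⟨ExteriorAlgebra.ιMulti F n v, ExteriorAlgebra.ιMulti_range F n (Set.mem_range_self v)⟩

/-- The product `w₁ ∧ ⋯ ∧ w_k ∧ x` for `x` in the `l`-th exterior power, landing in the
`n`-th exterior power, where `k + l = n`. -/
noncomputable def mulWedge (k l n : ℕ) (h : k + l = n) (w : Fin k → V) (x : ⋀[F]^l V) :
    ⋀[F]^n V :=
  ⟨ExteriorAlgebra.ιMulti F k w * (x : ExteriorAlgebra F V), by
    subst h
    have hmem : ExteriorAlgebra.ιMulti F k w * (x : ExteriorAlgebra F V) ∈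
        (LinearMap.range (ExteriorAlgebra.ι F : V →ₗ[F] ExteriorAlgebra F V)) ^ k *
          (LinearMap.range (ExteriorAlgebra.ι F : V →ₗ[F] ExteriorAlgebra F V)) ^ l :=
      Submodule.mul_mem_mul (ExteriorAlgebra.ιMulti_range F k (Set.mem_range_self w)) x.2
    rw [← pow_add] at hmem
    exact hmem⟩

/-- An `ℓ`-dimensional subspace `L` of `V` lies on the hyperplane of the Plücker projective
space determined by the nonzero functional `φ : ⋀[F]^ℓ V →ₗ[F] F` if
`φ (ω₁ ∧ ⋯ ∧ ω_ℓ) = 0` for some (equivalently, every) basis `ω₁, …, ω_ℓ` of `L`. -/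
def LiesOn (l : ℕ) (φ : ⋀[F]^l V →ₗ[F] F) (L : Submodule F V) : Prop :=
  ∃ ω : Fin l → V, (∀ i, ω i ∈ L) ∧ LinearIndependent F ω ∧
    Submodule.span F (Set.range ω) = L ∧ φ (wedge F V l ω) = 0

/-- The hyperplane determined by `φ : ⋀[F]^ℓ V →ₗ[F] F` is decomposable if there exist vectors
`w₁, …, w_{m−ℓ} ∈ V` and a nonzero linear functional `ψ : ⋀[F]^m V →ₗ[F] F` such that
`φ x = ψ (w₁ ∧ ⋯ ∧ w_{m−ℓ} ∧ x)` for all `x ∈ ⋀[F]^ℓ V`. -/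
def IsDecomposable (m l : ℕ) (h : l ≤ m) (φ : ⋀[F]^l V →ₗ[F] F) : Prop :=
  ∃ (w : Fin (m - l) → V) (ψ : ⋀[F]^m V →ₗ[F] F), ψ ≠ 0 ∧
    ∀ x : ⋀[F]^l V, φ x = ψ (mulWedge F V (m - l) l m (Nat.sub_add_cancel h) w x)

section AlternatingCount

variable {K E : Type*} [Field K] [AddCommGroup E] [Module K E]

/-- The number of tuples on which an alternating form does not vanish. -/
noncomputable def supportCard {n : ℕ} (f : E [⋀^Fin n]→ₗ[K] K) : ℕ :=
  Nat.card {x : Fin n → E // f x ≠ 0}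

/-- Adding multiples of one entry of a tuple to other entries does not change the value of an
alternating map. -/
lemma AlternatingMap.map_shear {ι : Type*} [DecidableEq ι] (f : E [⋀^ι]→ₗ[K] K) (x : ι → E)
    (b : ι → K) (i : ι) (s : Finset ι) (hi : i ∉ s) :
    f (fun k => if k ∈ s then x k + b k • x i else x k) = f x := by
  induction s using Finset.induction_on with
  | empty => simp
  | insert j s hj ih =>
    rw [Finset.mem_insert, not_or] at hi
    specialize ih hi.2
    set y : ι → E := fun k => if k ∈ s then x k + b k • x i else x k with hy
    have h1 : (fun k => if k ∈ insert j s then x k + b k • x i else x k) =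
        Function.update y j (y j + b j • y i) := by
      funext k
      by_cases hk : k = j
      · subst hk
        simp [hy, hj, hi.2]
      · simp [hy, hk]
    rw [h1, AlternatingMap.map_update_add, AlternatingMap.map_update_smul,
      AlternatingMap.map_update_self _ _ (Ne.symm hi.1), Function.update_eq_self, ih]
    simp

/-- The value of an alternating map at a tuple translated along a fixed vector. -/
lemma AlternatingMap.map_add_smul_vector {ι : Type*} [Fintype ι] [DecidableEq ι]
    (f : E [⋀^ι]→ₗ[K] K) (x : ι → E) (a : ι → K) (v : E) :
    f (fun k => x k + a k • v) = f x + ∑ i, a i * f (Function.update x i v) := by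
  suffices h : ∀ s : Finset ι, f (fun k => if k ∈ s then x k + a k • v else x k) =
      f x + ∑ i ∈ s, a i * f (Function.update x i v) by
    simpa using h Finset.univ
  intro s
  induction s using Finset.induction_on with
  | empty => simp
  | insert j s hj ih =>
    set y : ι → E := fun k => if k ∈ s then x k + a k • v else x k with hy
    have h1 : (fun k => if k ∈ insert j s then x k + a k • v else x k) =
        Function.update y j (y j + a j • v) := by
      funext k
      by_cases hk : k = j
      · subst hk
        simp [hy, hj]
      · simp [hy, hk]
    have h2 : f (Function.update y j v) = f (Function.update x j v) := by
      rw [← AlternatingMap.map_shear f (Function.update x j v) a j s hj]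
      congr 1
      funext k
      by_cases hk : k = j
      · subst hk
        simp [hj]
      · simp [hy, hk]
    rw [h1, AlternatingMap.map_update_add, AlternatingMap.map_update_smul,
      Function.update_eq_self, ih, h2, Finset.sum_insert hj, smul_eq_mul]
    ring

/-- Translating the entries of a tuple by multiples of `v`, not all zero, changes the value of `f`
for exactly `|E|` times as many tuples as there are in the support of the contraction by `v`. -/
lemma card_translate_ne [Finite E] {n : ℕ} (f : E [⋀^Fin (n + 1)]→ₗ[K] K) (v : E)
    (a : Fin (n + 1) → K) (ha : a ≠ 0) :
    Nat.card {x : Fin (n + 1) → E // f (fun k => x k + a k • v) ≠ f x} =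
      Nat.card E * supportCard (f.curryLeft v) := by
  obtain ⟨j, hj⟩ := Function.ne_iff.mp ha
  simp only [Pi.zero_apply] at hj
  let shear : (Fin (n + 1) → E) ≃ (Fin (n + 1) → E) :=
    { toFun := fun x k => if k ∈ Finset.univ.erase j then x k + (a k / a j) • x j else x k
      invFun := fun x k => if k ∈ Finset.univ.erase j then x k - (a k / a j) • x j else x k
      left_inv := fun x => by funext k; by_cases hk : k = j <;> simp [hk]
      right_inv := fun x => by funext k; by_cases hk : k = j <;> simp [hk] }
  have hshear : ∀ x, f (shear x) = f x := fun x =>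
    AlternatingMap.map_shear f x (fun k => a k / a j) j _ (Finset.notMem_erase _ _)
  have htrans : ∀ x, (fun k => shear x k + a k • v) =
      shear (Function.update x j (x j + a j • v)) := by
    intro x
    funext k
    by_cases hk : k = j
    · subst hk
      simp [shear]
    · simp only [shear, Equiv.coe_fn_mk, Finset.mem_erase, hk, ne_eq, not_false_eq_true,
        Finset.mem_univ, and_self, if_true, Function.update_of_ne, Function.update_self, smul_add,
        smul_smul, div_mul_cancel₀ _ hj, add_assoc]
  have e1 : {x : Fin (n + 1) → E // f (fun k => x k + a k • v) ≠ f x} ≃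
      {x : Fin (n + 1) → E // f (Function.update x j v) ≠ 0} :=
    (shear.subtypeEquiv fun x => by
      rw [htrans, hshear, hshear, AlternatingMap.map_update_add, AlternatingMap.map_update_smul,
        Function.update_eq_self]
      simp [hj]).symm
  have e2 : {x : Fin (n + 1) → E // f (Function.update x j v) ≠ 0} ≃
      {p : E × (Fin n → E) // f.curryLeft v p.2 ≠ 0} :=
    ((Fin.insertNthEquiv (fun _ => E) j).subtypeEquiv fun p => by
      have : f (j.insertNth v p.2) = _ := f.map_insertNth j v p.2
      have h0 : Function.update (Fin.insertNthEquiv (fun _ => E) j p) j v = j.insertNth v p.2 :=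
        Fin.update_insertNth (α := fun _ => E) j p.1 v p.2
      rw [h0, this, AlternatingMap.curryLeft_apply_apply]
      rcases neg_one_pow_eq_or ℤ (j : ℕ) with h | h <;> simp [h]).symm
  have e3 : {p : E × (Fin n → E) // f.curryLeft v p.2 ≠ 0} ≃
      E × {y : Fin n → E // f.curryLeft v y ≠ 0} :=
    { toFun := fun p => (p.1.1, ⟨p.1.2, p.2⟩)
      invFun := fun p => ⟨(p.1, p.2.1), p.2.2⟩
      left_inv := fun _ => rfl
      right_inv := fun _ => rfl }
  rw [Nat.card_congr (e1.trans (e2.trans e3)), Nat.card_prod, supportCard]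

/-- A linear form takes nonzero values at most as often as any of its translates by constants,
unless it vanishes. -/
lemma card_linear_ne_le {A : Type*} [AddCommGroup A] [Module K A] [Finite A] (g : A →ₗ[K] K)
    (c : K) : Nat.card {a // g a ≠ 0} ≤ Nat.card {a // c + g a ≠ 0} := by
  by_cases hg : g = 0
  · subst hg
    simp
  · obtain ⟨a₀, ha₀⟩ := LinearMap.surjective hg c
    refine Nat.card_le_card_of_injective
      (fun a => ⟨a.1 - a₀, by rw [map_sub, ha₀, add_sub_cancel]; exact a.2⟩) ?_
    intro a b h
    simpa [Subtype.ext_iff] using h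

/-- Contracting an alternating form by a vector lowers the density of its support by a bounded
factor only. -/
lemma supportCard_curryLeft_le [Finite K] [Finite E] {n : ℕ} (f : E [⋀^Fin (n + 1)]→ₗ[K] K)
    (v : E) : (Nat.card K ^ (n + 1) - 1) * (Nat.card E * supportCard (f.curryLeft v)) ≤
      Nat.card K ^ (n + 1) * supportCard f := by
  classical
  have := Fintype.ofFinite K
  have := Fintype.ofFinite E
  let tr : (Fin (n + 1) → K) → (Fin (n + 1) → E) → (Fin (n + 1) → E) :=
    fun a x k => x k + a k • v
  have hcard : Fintype.card (Fin (n + 1) → K) = Nat.card K ^ (n + 1) := by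
    simp [Nat.card_eq_fintype_card]
  have hleft : ∑ a : Fin (n + 1) → K, Nat.card {x // f (tr a x) ≠ f x} =
      (Nat.card K ^ (n + 1) - 1) * (Nat.card E * supportCard (f.curryLeft v)) := by
    rw [← Finset.add_sum_erase _ _ (Finset.mem_univ (0 : Fin (n + 1) → K)),
      Finset.sum_congr rfl fun a ha => card_translate_ne f v a (Finset.ne_of_mem_erase ha)]
    simp [tr, Nat.card_eq_fintype_card, Finset.card_erase_of_mem]
  have hright : ∑ a : Fin (n + 1) → K, Nat.card {x // f (tr a x) ≠ 0} =
      Nat.card K ^ (n + 1) * supportCard f := by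
    rw [Finset.sum_congr rfl fun a _ => Nat.card_congr
      ((Equiv.addRight (fun k => a k • v)).subtypeEquiv (q := fun x => f x ≠ 0) fun x => Iff.rfl),
      Finset.sum_const, Finset.card_univ, hcard, smul_eq_mul, supportCard]
  have hswap : ∀ P : (Fin (n + 1) → K) → (Fin (n + 1) → E) → Prop,
      ∑ a, Nat.card {x // P a x} = ∑ x, Nat.card {a // P a x} := by
    intro P
    simp only [Nat.card_eq_fintype_card, Fintype.card_subtype, Finset.card_filter]
    exact Finset.sum_comm
  rw [← hleft, ← hright, hswap, hswap]
  refine Finset.sum_le_sum fun x _ => ?_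
  let g : (Fin (n + 1) → K) →ₗ[K] K :=
    Fintype.linearCombination K fun i => f (Function.update x i v)
  have hg : ∀ a, f (tr a x) = f x + g a := fun a => by
    rw [AlternatingMap.map_add_smul_vector f x a v]
    simp [g, Fintype.linearCombination_apply]
  simpa [hg] using card_linear_ne_le g (f x)

/-- A sufficient condition, on an alternating form of degree two, for having rank at least four. -/
def HasRankFour (ω : E [⋀^Fin 2]→ₗ[K] K) : Prop :=
  ∃ a b c d, ω ![a, b] ≠ 0 ∧ ω ![c, d] ≠ 0 ∧ ω ![a, c] = 0 ∧ ω ![a, d] = 0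

/-- Some iterated contraction to degree two has rank at least four. -/
def HasRankFourContraction : (n : ℕ) → (E [⋀^Fin (n + 2)]→ₗ[K] K) → Prop
  | 0, ω => HasRankFour ω
  | n + 1, f => ∃ v, HasRankFourContraction n (f.curryLeft v)

lemma AlternatingMap.map_pair_swap (ω : E [⋀^Fin 2]→ₗ[K] K) (a b : E) :
    ω ![b, a] = -ω ![a, b] := by
  rw [← ω.map_swap ![a, b] (i := 0) (j := 1) (by decide)]
  congr 1
  funext i
  fin_cases i <;> simp

/-- The pairings of a form of rank at least four with four suitable vectors are independent. -/
lemma HasRankFour.exists_surjective {ω : E [⋀^Fin 2]→ₗ[K] K} (h : HasRankFour ω) :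
    ∃ u : Fin 4 → E, Function.Surjective fun y i => ω ![y, u i] := by
  obtain ⟨a, b, c, d, hab, hcd, hac, had⟩ := h
  refine ⟨![a, b, c, d], fun t => ?_⟩
  have hself : ∀ x, ω ![x, x] = 0 := fun x =>
    ω.map_eq_zero_of_eq _ (i := 0) (j := 1) rfl (by decide)
  have hlin : ∀ (α β γ δ : K) (z : E), ω ![α • a + β • b + γ • c + δ • d, z] =
      α * ω ![a, z] + β * ω ![b, z] + γ * ω ![c, z] + δ * ω ![d, z] := by
    intro α β γ δ z
    have := congrArg (fun g : E [⋀^Fin 1]→ₗ[K] K => g ![z])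
      (show ω.curryLeft (α • a + β • b + γ • c + δ • d) = α • ω.curryLeft a + β • ω.curryLeft b +
        γ • ω.curryLeft c + δ • ω.curryLeft d by simp only [map_add, map_smul])
    exact this
  have hba := ω.map_pair_swap a b
  have hca := ω.map_pair_swap a c
  have hda := ω.map_pair_swap a d
  have hdc := ω.map_pair_swap c d
  have hcb := ω.map_pair_swap b c
  have hdb := ω.map_pair_swap b d
  obtain ⟨β, hβ⟩ : ∃ β, β * ω ![a, b] = -t 0 := ⟨_, div_mul_cancel₀ _ hab⟩
  obtain ⟨δ, hδ⟩ : ∃ δ, δ * ω ![c, d] = β * ω ![b, c] - t 2 := ⟨_, div_mul_cancel₀ _ hcd⟩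
  obtain ⟨γ, hγ⟩ : ∃ γ, γ * ω ![c, d] = t 3 - β * ω ![b, d] := ⟨_, div_mul_cancel₀ _ hcd⟩
  obtain ⟨α, hα⟩ : ∃ α, α * ω ![a, b] = t 1 + γ * ω ![b, c] + δ * ω ![b, d] :=
    ⟨_, div_mul_cancel₀ _ hab⟩
  refine ⟨α • a + β • b + γ • c + δ • d, ?_⟩
  have ea := hlin α β γ δ a
  have eb := hlin α β γ δ b
  have ec := hlin α β γ δ c
  have ed := hlin α β γ δ d
  rw [hself, hba, hca, hda, hac, had] at ea
  rw [hself, hcb, hdb] at eb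
  rw [hself, hdc, hac] at ec
  rw [hself, had] at ed
  funext i
  fin_cases i
  · change ω ![_, a] = t 0
    linear_combination ea - hβ
  · change ω ![_, b] = t 1
    linear_combination eb + hα
  · change ω ![_, c] = t 2
    linear_combination ec - hδ
  · change ω ![_, d] = t 3
    linear_combination ed + hγ

lemma card_surjective_ker [Finite K] [Finite E] {A : Type*} [AddCommGroup A] [Module K A]
    (g : E →ₗ[K] A) (hg : Function.Surjective g) :
    Nat.card E = Nat.card (LinearMap.ker g) * Nat.card A := by
  rw [Submodule.card_eq_card_quotient_mul_card (LinearMap.ker g),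
    Nat.card_congr (g.quotKerEquivOfSurjective hg).toEquiv]

lemma supportCard_eq_sum [Fintype E] {n : ℕ} (f : E [⋀^Fin (n + 1)]→ₗ[K] K) :
    supportCard f = ∑ v, supportCard (f.curryLeft v) := by
  have e : {x : Fin (n + 1) → E // f x ≠ 0} ≃ Σ v : E, {y : Fin n → E // f.curryLeft v y ≠ 0} :=
    ((Fin.consEquiv fun _ => E).symm.subtypeEquiv (q := fun p : E × (Fin n → E) =>
        f.curryLeft p.1 p.2 ≠ 0) fun x => by
          rw [AlternatingMap.curryLeft_apply_apply]
          exact not_congr (by rw [← Fin.cons_self_tail x]; rfl)).trans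
      { toFun := fun p => ⟨p.1.1, p.1.2, p.2⟩
        invFun := fun p => ⟨(p.1, p.2.1), p.2.2⟩
        left_inv := fun _ => rfl
        right_inv := fun _ => rfl }
  simp only [supportCard]
  rw [Nat.card_congr e, Nat.card_sigma]

lemma supportCard_one_ge [Finite K] [Finite E] (g : E [⋀^Fin 1]→ₗ[K] K) (hg : g ≠ 0) :
    (Nat.card K - 1) * Nat.card E ≤ Nat.card K * supportCard g := by
  obtain ⟨x, hx⟩ : ∃ x, g x ≠ 0 := by
    by_contra! h
    exact hg (AlternatingMap.ext h)
  have h1 : supportCard (g.curryLeft (x 0)) = 1 := by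
    rw [supportCard, Nat.card_eq_one_iff_unique]
    refine ⟨⟨fun _ _ => Subtype.ext (Subsingleton.elim _ _)⟩, ⟨⟨![], ?_⟩⟩⟩
    rw [AlternatingMap.curryLeft_apply_apply]
    convert hx using 2
    funext i
    fin_cases i
    rfl
  simpa [h1] using supportCard_curryLeft_le g (x 0)

lemma HasRankFour.supportCard_ge [Finite K] [Finite E] {ω : E [⋀^Fin 2]→ₗ[K] K}
    (h : HasRankFour ω) :
    (Nat.card K ^ 4 - 1) * (Nat.card K - 1) * Nat.card E ^ 2 ≤
      Nat.card K ^ 5 * supportCard ω := by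
  classical
  have := Fintype.ofFinite E
  obtain ⟨u, hu⟩ := h.exists_surjective
  let g : E →ₗ[K] (Fin 4 → K) :=
    { toFun := fun y i => ω.curryLeft y ![u i]
      map_add' := fun x y => by funext i; simp only [map_add]; rfl
      map_smul' := fun c x => by funext i; simp only [map_smul]; rfl }
  have hcard : Nat.card E = Nat.card (LinearMap.ker g) * Nat.card K ^ 4 := by
    rw [card_surjective_ker g hu, Nat.card_fun, Nat.card_eq_fintype_card (α := Fin 4),
      Fintype.card_fin]
  have hle : ∀ y, (if y ∈ LinearMap.ker g then 0 else (Nat.card K - 1) * Nat.card E) ≤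
      Nat.card K * supportCard (ω.curryLeft y) := by
    intro y
    split_ifs with hy
    · exact Nat.zero_le _
    · refine supportCard_one_ge _ fun h0 => hy ?_
      rw [LinearMap.mem_ker]
      funext i
      simp [g, ← AlternatingMap.curryLeft_apply_apply, h0]
  have hsum := Finset.sum_le_sum fun y (_ : y ∈ Finset.univ) => hle y
  rw [← Finset.mul_sum, ← supportCard_eq_sum, Finset.sum_ite, Finset.sum_const_zero, zero_add,
    Finset.sum_const, smul_eq_mul, Finset.filter_not,
    Finset.card_sdiff_of_subset (Finset.filter_subset _ _), Finset.card_univ,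
    ← Fintype.card_subtype, ← Nat.card_eq_fintype_card, ← Nat.card_eq_fintype_card] at hsum
  change (Nat.card E - Nat.card (LinearMap.ker g)) * _ ≤ _ at hsum
  have hmul : (Nat.card E - Nat.card (LinearMap.ker g)) * Nat.card K ^ 4 =
      (Nat.card K ^ 4 - 1) * Nat.card E := by
    rw [Nat.sub_mul, ← hcard, Nat.sub_mul, one_mul, mul_comm]
  calc (Nat.card K ^ 4 - 1) * (Nat.card K - 1) * Nat.card E ^ 2
      = ((Nat.card K ^ 4 - 1) * Nat.card E) * ((Nat.card K - 1) * Nat.card E) := by ring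
    _ = Nat.card K ^ 4 *
        ((Nat.card E - Nat.card (LinearMap.ker g)) * ((Nat.card K - 1) * Nat.card E)) := by
        rw [← hmul]; ring
    _ ≤ Nat.card K ^ 4 * (Nat.card K * supportCard ω) := Nat.mul_le_mul_left _ hsum
    _ = Nat.card K ^ 5 * supportCard ω := by ring

/-- A lower bound for the support of a form with a contraction of rank at least four. -/
lemma HasRankFourContraction.supportCard_ge [Finite K] [Finite E] {n : ℕ}
    {f : E [⋀^Fin (n + 2)]→ₗ[K] K} (h : HasRankFourContraction n f) :
    (Nat.card E : ℚ) ^ (n + 2) * (1 + ((Nat.card K : ℚ) ^ 2)⁻¹) *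
      ∏ i ∈ Finset.range (n + 2), (1 - ((Nat.card K : ℚ) ^ (i + 1))⁻¹) ≤ supportCard f := by
  have hq : 1 ≤ Nat.card K := Nat.one_le_iff_ne_zero.mpr Nat.card_pos.ne'
  have hq0 : (0 : ℚ) < Nat.card K := by exact_mod_cast hq
  induction n with
  | zero =>
    have h2 := HasRankFour.supportCard_ge h
    have h3 : (((Nat.card K : ℚ) ^ 4 - 1) * (Nat.card K - 1) * (Nat.card E : ℚ) ^ 2) ≤
        (Nat.card K : ℚ) ^ 5 * supportCard f := by
      have := (Nat.cast_le (α := ℚ)).mpr h2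
      push_cast [Nat.one_le_pow _ _ hq, hq] at this
      exact this
    rw [← mul_le_mul_iff_right₀ (pow_pos hq0 5)]
    refine le_trans (le_of_eq ?_) h3
    simp only [Finset.prod_range_succ, Finset.prod_range_zero]
    field_simp
    ring
  | succ n ih =>
    obtain ⟨v, hv⟩ := h
    have h1 := ih hv
    have h2 := supportCard_curryLeft_le f v
    have h3 : ((Nat.card K : ℚ) ^ (n + 2 + 1) - 1) *
        (Nat.card E * supportCard (f.curryLeft v)) ≤
        (Nat.card K : ℚ) ^ (n + 2 + 1) * supportCard f := by
      have := (Nat.cast_le (α := ℚ)).mpr h2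
      push_cast [Nat.one_le_pow _ _ hq] at this
      exact this
    rw [← mul_le_mul_iff_right₀ (pow_pos hq0 (n + 2 + 1))]
    refine le_trans ?_ h3
    rw [show n + 1 + 2 = n + 2 + 1 from rfl, Finset.prod_range_succ]
    have h4 : (0 : ℚ) ≤ (Nat.card K : ℚ) ^ (n + 2 + 1) - 1 :=
      sub_nonneg.mpr (one_le_pow₀ (by exact_mod_cast hq))
    refine le_trans (le_of_eq ?_) (mul_le_mul_of_nonneg_left
      (mul_le_mul_of_nonneg_left h1 (Nat.cast_nonneg (Nat.card E))) h4)
    field_simp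
    ring

lemma HasRankFourContraction.of_update {n : ℕ} (f : E [⋀^Fin (n + 2)]→ₗ[K] K)
    (e : Fin (n + 2) → E) {i j : Fin (n + 2)} (hij : i ≠ j) {a b c d : E}
    (hab : f (Function.update (Function.update e i a) j b) ≠ 0)
    (hcd : f (Function.update (Function.update e i c) j d) ≠ 0)
    (hac : f (Function.update (Function.update e i a) j c) = 0)
    (had : f (Function.update (Function.update e i a) j d) = 0) :
    HasRankFourContraction n f := by
  induction n with
  | zero =>
    have h01 : ∀ x y : E, Function.update (Function.update e 0 x) 1 y = ![x, y] := by
      intro x y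
      funext k
      fin_cases k <;> simp
    have h10 : ∀ x y : E, Function.update (Function.update e 1 x) 0 y = ![y, x] := by
      intro x y
      funext k
      fin_cases k <;> simp
    refine ⟨a, b, c, d, ?_⟩
    fin_cases i <;> fin_cases j
    · exact absurd rfl hij
    · exact ⟨h01 a b ▸ hab, h01 c d ▸ hcd, h01 a c ▸ hac, h01 a d ▸ had⟩
    · refine ⟨?_, ?_, ?_, ?_⟩ <;> rw [AlternatingMap.map_pair_swap, ← h10]
      · exact neg_ne_zero.mpr hab
      · exact neg_ne_zero.mpr hcd
      · exact neg_eq_zero.mpr hac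
      · exact neg_eq_zero.mpr had
    · exact absurd rfl hij
  | succ n ih =>
    have key : ∀ (e : Fin (n + 1 + 2) → E) {i j : Fin (n + 1 + 2)}, i ≠ j → i ≠ 0 → j ≠ 0 →
        f (Function.update (Function.update e i a) j b) ≠ 0 →
        f (Function.update (Function.update e i c) j d) ≠ 0 →
        f (Function.update (Function.update e i a) j c) = 0 →
        f (Function.update (Function.update e i a) j d) = 0 →
        HasRankFourContraction (n + 1) f := by
      intro e i j hij hi hj hab hcd hac had
      obtain ⟨i, rfl⟩ := Fin.exists_succ_eq_of_ne_zero hi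
      obtain ⟨j, rfl⟩ := Fin.exists_succ_eq_of_ne_zero hj
      have hcons : ∀ x y : E, f (Function.update (Function.update e i.succ x) j.succ y) =
          f.curryLeft (e 0) (Function.update (Function.update (Fin.tail e) i x) j y) := by
        intro x y
        conv_lhs => rw [← Fin.cons_self_tail e, ← Fin.cons_update, ← Fin.cons_update]
        rfl
      rw [hcons] at hab hcd hac had
      exact ⟨e 0, ih (f.curryLeft (e 0)) (Fin.tail e) (by simpa using hij) hab hcd hac had⟩
    obtain ⟨p, hp⟩ : ∃ p : Fin (n + 1 + 2), p ∉ ({i, j} : Finset (Fin (n + 1 + 2))) := by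
      by_contra! h
      have h1 := Finset.card_le_card (fun p _ => h p : Finset.univ ⊆ ({i, j} : Finset _))
      have h2 := Finset.card_le_two (a := i) (b := j)
      simp only [Finset.card_univ, Fintype.card_fin] at h1
      omega
    simp only [Finset.mem_insert, Finset.mem_singleton, not_or] at hp
    let σ : Equiv.Perm (Fin (n + 1 + 2)) := Equiv.swap 0 p
    have hσ : ∀ r, r ≠ p → σ r ≠ 0 := fun r hr h => hr (by
      rw [← Equiv.swap_apply_right 0 p] at h
      exact absurd (σ.injective (h.trans (by simp [σ]) : σ r = σ p)) hr)
    have hperm : ∀ x y : E, f (Function.update (Function.update (e ∘ σ) (σ i) x) (σ j) y) =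
        Equiv.Perm.sign σ • f (Function.update (Function.update e i x) j y) := by
      intro x y
      rw [← f.map_perm]
      congr 1
      have hsymm : ∀ r, σ r = σ.symm r := fun r => by simp [σ]
      rw [hsymm i, hsymm j, ← Function.update_comp_equiv, ← Function.update_comp_equiv]
    refine key (e ∘ σ) (σ.injective.ne hij) (hσ i (Ne.symm hp.1)) (hσ j (Ne.symm hp.2)) ?_ ?_ ?_ ?_
      <;> rw [hperm]
    · exact (smul_ne_zero_iff_ne _).mpr hab
    · exact (smul_ne_zero_iff_ne _).mpr hcd
    · rw [hac, smul_zero]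
    · rw [had, smul_zero]

section NoRankFour

variable {n : ℕ} {f : E [⋀^Fin (n + 2)]→ₗ[K] K} (hf : ¬ HasRankFourContraction n f)
include hf

lemma map_update_update_eq_zero {e : Fin (n + 2) → E} (he : f e ≠ 0) {k : E}
    (hk : ∀ r, f (Function.update e r k) = 0) {i j : Fin (n + 2)} (hij : i ≠ j) (b : E) :
    f (Function.update (Function.update e i k) j b) = 0 := by
  by_contra hb
  refine hf (HasRankFourContraction.of_update f e hij hb (c := e i) (d := e j) ?_ ?_ ?_)
  · simpa using he
  · rw [← neg_eq_zero, ← f.map_swap _ hij, ← hk j]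
    congr 1
    funext r
    by_cases hi : r = i
    · subst hi
      simp [hij]
    · by_cases hj : r = j
      · subst hj
        simp [hij]
      · simp [hi, hj, Equiv.swap_apply_of_ne_of_ne hi hj]
  · rw [Function.update_comm hij, Function.update_eq_self]
    exact hk i

lemma map_piecewise_update_eq_zero (x : Fin (n + 2) → E) (i : Fin (n + 2))
    (t : Finset (Fin (n + 2))) (hit : i ∉ t) (k : E) (e : Fin (n + 2) → E) (he : f e ≠ 0)
    (hk : ∀ r, f (Function.update e r k) = 0) :
    f (t.piecewise x (Function.update e i k)) = 0 := by
  induction t using Finset.induction_on generalizing e with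
  | empty => simpa using hk i
  | insert j t hj ih =>
    rw [Finset.mem_insert, not_or] at hit
    have hmap : ∀ c : K, f (Function.update e j (c • e j + x j)) =
        c * f e + f (Function.update e j (x j)) := fun c => by
      rw [AlternatingMap.map_update_add, AlternatingMap.map_update_smul, Function.update_eq_self,
        smul_eq_mul]
    obtain ⟨c, hc⟩ : ∃ c : K, f (Function.update e j (c • e j + x j)) ≠ 0 := by
      by_contra! h
      have h0 := h 0
      have h1 := h 1
      rw [hmap] at h0 h1
      exact he (by linear_combination h1 - h0)
    have hk' : ∀ r, f (Function.update (Function.update e j (c • e j + x j)) r k) = 0 := by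
      intro r
      by_cases hr : r = j
      · subst hr
        simpa using hk r
      · rw [Function.update_comm (Ne.symm hr)]
        exact map_update_update_eq_zero hf he hk hr _
    have h1 := ih hit.2 _ hc hk'
    have h2 := ih hit.2 e he hk
    rw [Function.update_comm (Ne.symm hit.1), ← Finset.update_piecewise_of_notMem _ _ _ hj,
      AlternatingMap.map_update_add, AlternatingMap.map_update_smul] at h1
    have h3 : Function.update (t.piecewise x (Function.update e i k)) j (e j) =
        t.piecewise x (Function.update e i k) := by
      rw [Function.update_eq_self_iff, Finset.piecewise_eq_of_notMem _ _ _ hj,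
        Function.update_of_ne (Ne.symm hit.1)]
    rw [h3, h2, smul_zero, zero_add] at h1
    rw [Finset.piecewise_insert, h1]

lemma map_eq_zero_of_forall_update {e : Fin (n + 2) → E} (he : f e ≠ 0)
    {x : Fin (n + 2) → E} {i : Fin (n + 2)} (hk : ∀ r, f (Function.update e r (x i)) = 0) :
    f x = 0 := by
  rw [← map_piecewise_update_eq_zero hf x i (Finset.univ.erase i) (Finset.notMem_erase _ _)
    (x i) e he hk]
  congr 1
  funext r
  by_cases hr : r = i
  · subst hr
    simp
  · simp [hr]

/-- A form without contractions of rank at least four has the smallest possible support. -/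
lemma supportCard_le_of_not_hasRankFourContraction [Fintype K] [Finite E] :
    supportCard f * (Fintype.card K ^ (n + 2)) ^ (n + 2) ≤
      (∏ i : Fin (n + 2), (Fintype.card K ^ (n + 2) - Fintype.card K ^ i.val)) *
        Nat.card E ^ (n + 2) := by
  by_cases hex : ∃ e, f e ≠ 0
  swap
  · push Not at hex
    have : supportCard f = 0 := by
      simp [supportCard, hex]
    rw [this, zero_mul]
    exact Nat.zero_le _
  obtain ⟨e, he⟩ := hex
  let g : E →ₗ[K] (Fin (n + 2) → K) := LinearMap.pi fun r => f.toMultilinearMap.toLinearMap e r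
  have hgr : ∀ y r, g y r = f (Function.update e r y) := fun _ _ => rfl
  have hge : ∀ j, g (e j) = Pi.single j (f e) := by
    intro j
    funext r
    rw [hgr]
    by_cases hr : r = j
    · subst hr
      simp
    · rw [f.map_update_self _ hr, Pi.single_eq_of_ne hr]
  have hg : Function.Surjective g := by
    intro t
    refine ⟨∑ j, (t j / f e) • e j, ?_⟩
    simp only [map_sum, map_smul, hge]
    funext r
    simp [Finset.sum_apply, Pi.single_apply, he]
  have hind : ∀ x, f x ≠ 0 → LinearIndependent K fun i => g (x i) := by
    intro x hx
    rw [Fintype.linearIndependent_iff]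
    intro c hc i
    have h1 : g (∑ i, c i • x i) = 0 := by simpa using hc
    have h2 : f (Function.update x i (∑ i, c i • x i)) = 0 :=
      map_eq_zero_of_forall_update hf (i := i) he fun r => by
        rw [Function.update_self, ← hgr, h1, Pi.zero_apply]
    rw [f.map_update_sum, Finset.sum_eq_single i] at h2
    · simpa [hx] using h2
    · intro j _ hj
      rw [AlternatingMap.map_update_smul, f.map_update_self _ (Ne.symm hj), smul_zero]
    · simp
  choose s hs using hg
  have hle : supportCard f ≤ Nat.card ({y : Fin (n + 2) → (Fin (n + 2) → K) //
      LinearIndependent K y} × (Fin (n + 2) → LinearMap.ker g)) := by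
    refine Nat.card_le_card_of_injective (fun x => (⟨fun i => g (x.1 i), hind x.1 x.2⟩,
      fun i => ⟨x.1 i - s (g (x.1 i)), by simp [hs]⟩)) ?_
    intro x y hxy
    simp only [Prod.mk.injEq, Subtype.mk.injEq, funext_iff] at hxy
    ext i
    have h1 : g (x.1 i) = g (y.1 i) := funext (hxy.1 i)
    have h2 := hxy.2 i
    rw [h1] at h2
    exact sub_left_injective h2
  rw [Nat.card_prod, Nat.card_fun, card_linearIndependent (by simp)] at hle
  simp only [Module.finrank_fintype_fun_eq_card, Fintype.card_fin,
    Nat.card_eq_fintype_card (α := Fin (n + 2))] at hle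
  have hE := card_surjective_ker g fun t => ⟨s t, hs t⟩
  rw [Nat.card_fun, Nat.card_eq_fintype_card (α := K),
    Nat.card_eq_fintype_card (α := Fin (n + 2)), Fintype.card_fin] at hE
  rw [hE, mul_pow, ← mul_assoc]
  exact Nat.mul_le_mul_right _ hle

end NoRankFour

/-- Sorting the independent tuples by their span, according to whether the form vanishes. -/
lemma card_vanishing_mul_add_supportCard [Fintype K] [Finite E] {l : ℕ} (hl : l ≤ finrank K E)
    (f : E [⋀^Fin l]→ₗ[K] K) :
    Nat.card {L : Submodule K E // finrank K L = l ∧ ∃ ω : Fin l → E, (∀ i, ω i ∈ L) ∧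
        LinearIndependent K ω ∧ Submodule.span K (Set.range ω) = L ∧ f ω = 0} *
      ∏ i : Fin l, (Fintype.card K ^ l - Fintype.card K ^ i.val) + supportCard f =
      ∏ i : Fin l, (Fintype.card K ^ finrank K E - Fintype.card K ^ i.val) := by
  classical
  set S := {L : Submodule K E // finrank K L = l ∧ ∃ ω : Fin l → E, (∀ i, ω i ∈ L) ∧
        LinearIndependent K ω ∧ Submodule.span K (Set.range ω) = L ∧ f ω = 0}
  have := Fintype.ofFinite S
  let X := {x : Fin l → E // LinearIndependent K x ∧ f x = 0}
  let π : X → S := fun x => ⟨Submodule.span K (Set.range x.1),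
    by rw [finrank_span_eq_card x.2.1, Fintype.card_fin], x.1,
    fun i => Submodule.subset_span (Set.mem_range_self i), x.2.1, rfl, x.2.2⟩
  have hspan : ∀ (L : S) (y : Fin l → L.1), LinearIndependent K y →
      Submodule.span K (Set.range y) = ⊤ := fun L y hy =>
    hy.span_eq_top_of_card_eq_finrank' (by rw [Fintype.card_fin, L.2.1])
  have hzero : ∀ (L : S) (y : Fin l → L.1), LinearIndependent K y →
      f (fun i => (y i : E)) = 0 := by
    intro L y hy
    obtain ⟨L, hL, ω, hmem, hind, hsp, hfω⟩ := L
    have hω : LinearIndependent K fun i => (⟨ω i, hmem i⟩ : L) :=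
      LinearIndependent.of_comp L.subtype hind
    let b := Basis.mk hω (hspan ⟨L, hL, ω, hmem, hind, hsp, hfω⟩ _ hω).ge
    have h0 : f.compLinearMap L.subtype = 0 := by
      rw [← AlternatingMap.map_basis_eq_zero_iff b]
      simpa [b] using hfω
    exact congrArg (fun g : L [⋀^Fin l]→ₗ[K] K => g y) h0
  have hfib : ∀ L : S, Nat.card {x // π x = L} =
      ∏ i : Fin l, (Fintype.card K ^ l - Fintype.card K ^ i.val) := by
    intro L
    have hc := card_linearIndependent (K := K) (V := L.1) (k := l) L.2.1.ge
    rw [L.2.1] at hc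
    rw [← hc]
    have hmem : ∀ (x : {x // π x = L}) (i : Fin l), x.1.1 i ∈ L.1 := fun x i => by
      rw [← congrArg Subtype.val x.2]
      exact Submodule.subset_span (Set.mem_range_self i)
    exact Nat.card_congr
      { toFun := fun x => ⟨fun i => ⟨x.1.1 i, hmem x i⟩,
          LinearIndependent.of_comp L.1.subtype x.1.2.1⟩
        invFun := fun y => ⟨⟨fun i => y.1 i, y.2.map' L.1.subtype (Submodule.ker_subtype _),
          hzero L y.1 y.2⟩, Subtype.ext (by
            have h1 := congrArg (Submodule.map L.1.subtype) (hspan L y.1 y.2)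
            rw [Submodule.map_span, ← Set.range_comp, Submodule.map_top,
              Submodule.range_subtype] at h1
            exact h1)⟩
        left_inv := fun _ => rfl
        right_inv := fun _ => rfl }
  have hX : Nat.card X =
      Nat.card S * ∏ i : Fin l, (Fintype.card K ^ l - Fintype.card K ^ i.val) := by
    rw [← Nat.card_congr (Equiv.sigmaFiberEquiv π), Nat.card_sigma,
      Finset.sum_congr rfl fun L _ => hfib L, Finset.sum_const, Finset.card_univ, smul_eq_mul,
      Nat.card_eq_fintype_card]
  rw [← hX, ← card_linearIndependent hl, supportCard, ← Nat.card_sum]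
  exact Nat.card_congr
    { toFun := fun x => x.elim (fun a => ⟨a.1, a.2.1⟩) fun a =>
        ⟨a.1, by_contra fun h => a.2 (f.map_linearDependent _ h)⟩
      invFun := fun x => if h : f x.1 = 0 then Sum.inl ⟨x.1, x.2, h⟩ else Sum.inr ⟨x.1, h⟩
      left_inv := by
        rintro (⟨x, hx⟩ | ⟨x, hx⟩)
        · simp [hx.2]
        · simp [hx]
      right_inv := fun x => by
        by_cases h : f x.1 = 0 <;> simp [h] }

end AlternatingCount

lemma cast_prod_pow_sub_pow {q : ℕ} (hq : 2 ≤ q) {m l : ℕ} (hlm : l ≤ m) :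
    ((∏ i : Fin l, (q ^ m - q ^ i.val) : ℕ) : ℚ) =
      ∏ i ∈ Finset.range l, ((q : ℚ) ^ i * ((q : ℚ) ^ (m - i) - 1)) := by
  rw [Nat.cast_prod, Finset.prod_range]
  refine Finset.prod_congr rfl fun i _ => ?_
  have hi : i.val ≤ m := by omega
  rw [Nat.cast_sub (Nat.pow_le_pow_right (by omega) hi), mul_sub, ← pow_add,
    Nat.add_sub_cancel' hi]
  simp

lemma gaussBinom_mul_prod {q : ℕ} (hq : 2 ≤ q) {m l : ℕ} (hlm : l ≤ m) :
    gaussBinom q m l * ((∏ i : Fin l, (q ^ l - q ^ i.val) : ℕ) : ℚ) =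
      ((∏ i : Fin l, (q ^ m - q ^ i.val) : ℕ) : ℚ) := by
  have hq1 : (1 : ℚ) < q := by exact_mod_cast (show 1 < q by omega)
  rw [cast_prod_pow_sub_pow hq hlm, cast_prod_pow_sub_pow hq le_rfl, gaussBinom,
    Finset.prod_div_distrib, Finset.prod_mul_distrib, Finset.prod_mul_distrib,
    ← Finset.prod_range_reflect (fun i => (q : ℚ) ^ (l - i) - 1)]
  have h1 : ∏ i ∈ Finset.range l, ((q : ℚ) ^ (l - (l - 1 - i)) - 1) =
      ∏ i ∈ Finset.range l, ((q : ℚ) ^ (i + 1) - 1) :=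
    Finset.prod_congr rfl fun i hi => by
      rw [Finset.mem_range] at hi
      rw [show l - (l - 1 - i) = i + 1 by omega]
  have h2 : ∏ i ∈ Finset.range l, ((q : ℚ) ^ (i + 1) - 1) ≠ 0 :=
    Finset.prod_ne_zero_iff.mpr fun i _ => (sub_pos.mpr (one_lt_pow₀ hq1 (by omega))).ne'
  rw [h1]
  field_simp

lemma cast_prod_pow_sub_pow_self {q : ℕ} (hq : 2 ≤ q) (l : ℕ) :
    ((∏ i : Fin l, (q ^ l - q ^ i.val) : ℕ) : ℚ) =
      ((q : ℚ) ^ l) ^ l * ∏ i ∈ Finset.range l, (1 - ((q : ℚ) ^ (i + 1))⁻¹) := by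
  have hq0 : (q : ℚ) ≠ 0 := by exact_mod_cast (show q ≠ 0 by omega)
  rw [Nat.cast_prod, Finset.prod_range fun i => 1 - ((q : ℚ) ^ (i + 1))⁻¹,
    (Fin.prod_const l ((q : ℚ) ^ l)).symm,
    ← Equiv.prod_comp Fin.revPerm (fun i : Fin l => 1 - ((q : ℚ) ^ (i.val + 1))⁻¹),
    ← Finset.prod_mul_distrib]
  refine Finset.prod_congr rfl fun i _ => ?_
  rw [Nat.cast_sub (Nat.pow_le_pow_right (by omega) i.2.le), mul_sub, mul_one, Fin.revPerm_apply,
    Fin.val_rev, show l - (i.val + 1) + 1 = l - i.val by omega, Nat.cast_pow, Nat.cast_pow]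
  congr 1
  rw [eq_mul_inv_iff_mul_eq₀ (pow_ne_zero _ hq0), ← pow_add, Nat.add_sub_cancel' i.2.le]

/-- **Second minimum weight of Grassmann codes.** If `2 ≤ ℓ ≤ m−2` and `Π` is a hyperplane of
the Plücker projective space `P(⋀^ℓ V)` with `|Π ∩ G(ℓ,V)| < e(ℓ,m)`, then
`|Π ∩ G(ℓ,V)| ≤ e'(ℓ,m) = [m ℓ]_q − q^{ℓ(m−ℓ)} − q^{ℓ(m−ℓ)−2}`. -/
theorem stmt2 (F : Type*) [Field F] [Fintype F] (V : Type*) [AddCommGroup V] [Module F V]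
    [FiniteDimensional F V] (q m l : ℕ) (hq : Fintype.card F = q)
    (hV : finrank F V = m) (hl : 2 ≤ l) (hlm : l ≤ m - 2)
    (φ : ⋀[F]^l V →ₗ[F] F) (hφ : φ ≠ 0)
    (hlt : (Nat.card {L : Submodule F V | finrank F L = l ∧ LiesOn F V l φ L} : ℚ) <
      eG q l m) :
    (Nat.card {L : Submodule F V | finrank F L = l ∧ LiesOn F V l φ L} : ℚ) ≤
      eG' q l m := by
  subst hq
  subst hV
  set q := Fintype.card F with hq
  set m := finrank F V with hm
  have hq2 : 2 ≤ q := Fintype.one_lt_card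
  have hq0 : (0 : ℚ) < q := by exact_mod_cast (show 0 < q by omega)
  have hFq : Nat.card F = q := Nat.card_eq_fintype_card
  have : Finite V := Module.finite_of_finite F
  have hVq : (Nat.card V : ℚ) = (q : ℚ) ^ m := by
    rw [Module.natCard_eq_pow_finrank (K := F), hFq, Nat.cast_pow]
  obtain ⟨n, rfl⟩ : ∃ n, l = n + 2 := ⟨l - 2, by omega⟩
  let f : V [⋀^Fin (n + 2)]→ₗ[F] F := φ.compAlternatingMap (exteriorPower.ιMulti F (n + 2))
  have hcount := card_vanishing_mul_add_supportCard (show n + 2 ≤ finrank F V by omega) f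
  set G : ℕ := ∏ i : Fin (n + 2), (q ^ (n + 2) - q ^ i.val) with hG
  set c : ℕ := Nat.card {L : Submodule F V | finrank F L = n + 2 ∧ LiesOn F V (n + 2) φ L}
  change c * G + supportCard f = ∏ i : Fin (n + 2), (q ^ m - q ^ i.val) at hcount
  have hcountQ : (c : ℚ) * G + supportCard f = gaussBinom q m (n + 2) * G := by
    rw [gaussBinom_mul_prod hq2 (by omega), ← hcount]
    push_cast
    rfl
  have hGpos : (0 : ℚ) < G := by
    rw [Nat.cast_pos]
    exact Finset.prod_pos fun i _ => Nat.sub_pos_of_lt (Nat.pow_lt_pow_right (by omega) i.2)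
  have hGq := cast_prod_pow_sub_pow_self hq2 (n + 2)
  rw [← hG] at hGq
  have hpow : ((q : ℚ) ^ m) ^ (n + 2) =
      ((q : ℚ) ^ (n + 2)) ^ (n + 2) * (q : ℚ) ^ ((n + 2) * (m - (n + 2))) := by
    rw [← pow_mul, ← pow_mul, ← pow_add, mul_comm m, ← mul_add, Nat.add_sub_cancel' (by omega)]
  set δ := (n + 2) * (m - (n + 2)) with hδ
  have hδ2 : 2 ≤ δ := le_trans (show 2 ≤ m - (n + 2) by omega) (Nat.le_mul_of_pos_left _ (by omega))
  by_cases hf : HasRankFourContraction n f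
  · have h1 := hf.supportCard_ge
    rw [hFq, hVq, hpow] at h1
    have h2 : (q : ℚ) ^ (δ - 2) = (q : ℚ) ^ δ * ((q : ℚ) ^ 2)⁻¹ := pow_sub₀ _ hq0.ne' hδ2
    have h3 : ((q : ℚ) ^ δ + (q : ℚ) ^ (δ - 2)) * G ≤ supportCard f := by
      rw [h2, hGq]
      refine le_trans (le_of_eq ?_) h1
      ring
    refine le_of_mul_le_mul_right ?_ hGpos
    rw [eG', ← hδ]
    linarith
  · have h1 := (Nat.cast_le (α := ℚ)).mpr (supportCard_le_of_not_hasRankFourContraction hf)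
    rw [← hq, ← hG] at h1
    push_cast at h1
    rw [hVq, hpow] at h1
    have h2 : (supportCard f : ℚ) ≤ G * (q : ℚ) ^ δ := by
      refine le_of_mul_le_mul_right (h1.trans (le_of_eq ?_)) (pow_pos (pow_pos hq0 (n + 2)) (n + 2))
      ring
    have h3 := mul_lt_mul_of_pos_right hlt hGpos
    rw [eG, ← hδ] at h3
    linarith
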